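/- Let g(A) be the derived Kac–Moody algebra of a symmetrizable generalized Cartan matrix A, ω its Chevalley involution, and k(A) := {x ∈ g(A) : ω(x) = x} the fixed-point Lie subalgebra. Then k(A) is generated as a Lie algebra by the elements Y_1, …, Y_n, where Y_i := e_i − f_i. -/

import Mathlib

/-! Preamble: the derived Kac–Moody algebra of a symmetrizable generalized Cartan matrix,
presented by Chevalley generators and the Serre relations. -/

/-- The generators `e i`, `f i`, `h i` of the derived Kac–Moody algebra. -/
inductive KMGen (n : ℕ) : Type
  | E : Fin n → KMGen n
  | F : Fin n → KMGen n
  | H : Fin n → KMGen n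

/-- A symmetrizable generalized Cartan matrix. -/
structure GCM (n : ℕ) where
  a : Fin n → Fin n → ℤ
  diag : ∀ i, a i i = 2
  off_nonpos : ∀ i j, i ≠ j → a i j ≤ 0
  zero_iff : ∀ i j, a i j = 0 ↔ a j i = 0
  symmetrizable : ∃ d : Fin n → ℚ, (∀ i, 0 < d i) ∧ ∀ i j, d i * a i j = d j * a j i

namespace KacMoody

variable {n : ℕ}

/-- The free Lie algebra over `ℂ` on the generators. -/
abbrev FL (n : ℕ) : Type := FreeLieAlgebra ℂ (KMGen n)

noncomputable def Ef (i : Fin n) : FL n := FreeLieAlgebra.of ℂ (KMGen.E i)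
noncomputable def Ff (i : Fin n) : FL n := FreeLieAlgebra.of ℂ (KMGen.F i)
noncomputable def Hf (i : Fin n) : FL n := FreeLieAlgebra.of ℂ (KMGen.H i)

/-- The defining relations of the derived Kac–Moody algebra. -/
noncomputable def relations (A : GCM n) : Set (FL n) :=
  (Set.range fun p : Fin n × Fin n => ⁅Hf p.1, Hf p.2⁆) ∪
  (Set.range fun p : Fin n × Fin n => ⁅Hf p.1, Ef p.2⁆ - (A.a p.1 p.2 : ℂ) • Ef p.2) ∪
  (Set.range fun p : Fin n × Fin n => ⁅Hf p.1, Ff p.2⁆ + (A.a p.1 p.2 : ℂ) • Ff p.2) ∪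
  (Set.range fun p : Fin n × Fin n =>
    ⁅Ef p.1, Ff p.2⁆ - if p.1 = p.2 then Hf p.1 else 0) ∪
  {x | ∃ i j : Fin n, i ≠ j ∧
    x = ((LieAlgebra.ad ℂ (FL n) (Ef i)) ^ (1 - A.a i j).toNat) (Ef j)} ∪
  {x | ∃ i j : Fin n, i ≠ j ∧
    x = ((LieAlgebra.ad ℂ (FL n) (Ff i)) ^ (1 - A.a i j).toNat) (Ff j)}

/-- The Lie ideal generated by the relations. -/
noncomputable def relIdeal (A : GCM n) : LieIdeal ℂ (FL n) :=
  LieSubmodule.lieSpan ℂ (FL n) (relations A)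

/-- The derived Kac–Moody algebra `g(A)`. -/
abbrev KM (A : GCM n) : Type := FL n ⧸ relIdeal A

/-- The Chevalley generators of `g(A)`. -/
noncomputable def e (A : GCM n) (i : Fin n) : KM A :=
  LieSubmodule.Quotient.mk (N := relIdeal A) (Ef i)

noncomputable def f (A : GCM n) (i : Fin n) : KM A :=
  LieSubmodule.Quotient.mk (N := relIdeal A) (Ff i)

noncomputable def h (A : GCM n) (i : Fin n) : KM A :=
  LieSubmodule.Quotient.mk (N := relIdeal A) (Hf i)

/-- `Y i = e i - f i`. -/
noncomputable def Y (A : GCM n) (i : Fin n) : KM A := e A i - f A i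

end KacMoody

namespace KacMoody

variable {n : ℕ}

theorem mk_rel (A : GCM n) {x : FL n} (hx : x ∈ relations A) :
    (LieSubmodule.Quotient.mk (N := relIdeal A) x : KM A) = 0 := by
  rw [LieSubmodule.Quotient.mk_eq_zero']
  exact LieSubmodule.subset_lieSpan hx

theorem hh_rel (A : GCM n) (i j : Fin n) : ⁅h A i, h A j⁆ = 0 := by
  have := mk_rel A (x := ⁅Hf i, Hf j⁆)
    (Or.inl (Or.inl (Or.inl (Or.inl (Or.inl ⟨(i, j), rfl⟩)))))
  exact this

theorem he_rel (A : GCM n) (i j : Fin n) : ⁅h A i, e A j⁆ = (A.a i j : ℂ) • e A j := by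
  have := mk_rel A (x := ⁅Hf i, Ef j⁆ - (A.a i j : ℂ) • Ef j)
    (Or.inl (Or.inl (Or.inl (Or.inl (Or.inr ⟨(i, j), rfl⟩)))))
  exact sub_eq_zero.mp this

theorem hf_rel (A : GCM n) (i j : Fin n) : ⁅h A i, f A j⁆ = -((A.a i j : ℂ) • f A j) := by
  have := mk_rel A (x := ⁅Hf i, Ff j⁆ + (A.a i j : ℂ) • Ff j)
    (Or.inl (Or.inl (Or.inl (Or.inr ⟨(i, j), rfl⟩))))
  exact eq_neg_of_add_eq_zero_left this

theorem ef_rel (A : GCM n) (i j : Fin n) : ⁅e A i, f A j⁆ = if i = j then h A i else 0 := by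
  have := mk_rel A (x := ⁅Ef i, Ff j⁆ - if i = j then Hf i else 0)
    (Or.inl (Or.inl (Or.inr ⟨(i, j), rfl⟩)))
  split_ifs at this ⊢ with hij
  · exact sub_eq_zero.mp this
  · rw [sub_zero] at this
    exact this

/-- A Lie subalgebra containing the generators is everything. -/
theorem mem_of_gens (A : GCM n) (K : LieSubalgebra ℂ (KM A))
    (h1 : ∀ i, e A i ∈ K) (h2 : ∀ i, f A i ∈ K) (h3 : ∀ i, h A i ∈ K) (x : KM A) : x ∈ K := by
  let g : KMGen n → K := fun s => match s with
    | KMGen.E i => ⟨e A i, h1 i⟩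
    | KMGen.F i => ⟨f A i, h2 i⟩
    | KMGen.H i => ⟨h A i, h3 i⟩
  let π : FL n →ₗ⁅ℂ⁆ KM A :=
    { toLinearMap := (LieSubmodule.Quotient.mk' (relIdeal A) : FL n →ₗ[ℂ] KM A)
      map_lie' := fun {x y} => rfl }
  have key : K.incl.comp (FreeLieAlgebra.lift ℂ g) = π := by
    apply FreeLieAlgebra.hom_ext
    intro s
    cases s <;> simp [g] <;> rfl
  obtain ⟨y, rfl⟩ := LieSubmodule.Quotient.surjective_mk' (relIdeal A) x
  have h4 : ((FreeLieAlgebra.lift ℂ g y : K) : KM A) = LieSubmodule.Quotient.mk' (relIdeal A) y :=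
    LieHom.congr_fun key y
  rw [← h4]
  exact SetLike.coe_mem _

/-- The filtration of the nonnegative part. -/
noncomputable def V (A : GCM n) : ℕ → Submodule ℂ (KM A)
  | 0 => Submodule.span ℂ (Set.range (h A))
  | k + 1 => V A k ⊔ ⨆ i, (V A k).map (LieAlgebra.ad ℂ (KM A) (e A i) : KM A →ₗ[ℂ] KM A)

theorem V_mono (A : GCM n) (k : ℕ) : V A k ≤ V A (k + 1) := le_sup_left

theorem e_V (A : GCM n) {k : ℕ} (i : Fin n) {x : KM A} (hx : x ∈ V A k) :
    ⁅e A i, x⁆ ∈ V A (k + 1) :=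
  Submodule.mem_sup_right (Submodule.mem_iSup_of_mem i ⟨x, hx, rfl⟩)

theorem h_V0 (A : GCM n) (i : Fin n) : h A i ∈ V A 0 := Submodule.subset_span ⟨i, rfl⟩

theorem V_zero_le (A : GCM n) (N : Submodule ℂ (KM A)) (h0 : ∀ i, h A i ∈ N) : V A 0 ≤ N := by
  refine Submodule.span_le.mpr ?_
  rintro _ ⟨i, rfl⟩
  exact h0 i

theorem V_succ_le (A : GCM n) (k : ℕ) (N : Submodule ℂ (KM A)) (h0 : V A k ≤ N)
    (h1 : ∀ i, ∀ x ∈ V A k, ⁅e A i, x⁆ ∈ N) : V A (k + 1) ≤ N := by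
  refine sup_le h0 (iSup_le fun i => ?_)
  rintro _ ⟨x, hx, rfl⟩
  exact h1 i x hx

theorem e_V1 (A : GCM n) (i : Fin n) : e A i ∈ V A 1 := by
  have h1 := e_V A i (h_V0 A i)
  rw [← lie_skew, he_rel, A.diag] at h1
  have h2 := (V A 1).smul_mem (-(1/2 : ℂ)) h1
  convert h2 using 1
  module

theorem h_V (A : GCM n) (j : Fin n) (k : ℕ) : ∀ x ∈ V A k, ⁅h A j, x⁆ ∈ V A k := by
  induction k with
  | zero =>
    apply V_zero_le A ((V A 0).comap (LieAlgebra.ad ℂ (KM A) (h A j) : KM A →ₗ[ℂ] KM A))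
    intro i
    simp [hh_rel]
  | succ k ih =>
    apply V_succ_le A k
      ((V A (k+1)).comap (LieAlgebra.ad ℂ (KM A) (h A j) : KM A →ₗ[ℂ] KM A))
    · intro x hx
      exact V_mono A k (ih x hx)
    · intro i x hx
      change ⁅h A j, ⁅e A i, x⁆⁆ ∈ V A (k+1)
      rw [leibniz_lie, he_rel, smul_lie]
      exact add_mem (Submodule.smul_mem _ _ (e_V A i hx)) (e_V A i (ih x hx))

theorem f_V0 (A : GCM n) (j : Fin n) :
    ∀ x ∈ V A 0, ⁅f A j, x⁆ ∈ Submodule.span ℂ {f A j} := by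
  apply V_zero_le A
    ((Submodule.span ℂ {f A j}).comap (LieAlgebra.ad ℂ (KM A) (f A j) : KM A →ₗ[ℂ] KM A))
  intro i
  change ⁅f A j, h A i⁆ ∈ Submodule.span ℂ {f A j}
  rw [← lie_skew, hf_rel, neg_neg]
  exact Submodule.smul_mem _ _ (Submodule.mem_span_singleton_self _)

theorem fe_V (A : GCM n) (j i : Fin n) (k : ℕ) (x : KM A) (hx : x ∈ V A k) :
    ⁅⁅f A j, e A i⁆, x⁆ ∈ V A k := by
  rw [← lie_skew (f A j), ef_rel]
  split_ifs
  · rw [neg_lie]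
    exact neg_mem (h_V A i k x hx)
  · simp

theorem ef_span (A : GCM n) (i j : Fin n) (k : ℕ) (x : KM A)
    (hx : x ∈ Submodule.span ℂ {f A j}) : ⁅e A i, x⁆ ∈ V A k := by
  have hmono : V A 0 ≤ V A k := monotone_nat_of_le_succ (V_mono A) (Nat.zero_le k)
  obtain ⟨c, rfl⟩ := Submodule.mem_span_singleton.mp hx
  rw [lie_smul, ef_rel]
  apply Submodule.smul_mem
  split_ifs
  · exact hmono (h_V0 A i)
  · exact zero_mem _

theorem f_V (A : GCM n) (j : Fin n) (k : ℕ) : ∀ x ∈ V A (k + 1),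
    ⁅f A j, x⁆ ∈ V A k ⊔ Submodule.span ℂ {f A j} := by
  induction k with
  | zero =>
    apply V_succ_le A 0 ((V A 0 ⊔ Submodule.span ℂ {f A j}).comap
      (LieAlgebra.ad ℂ (KM A) (f A j) : KM A →ₗ[ℂ] KM A))
    · intro x hx
      exact Submodule.mem_sup_right (f_V0 A j x hx)
    · intro i x hx
      change ⁅f A j, ⁅e A i, x⁆⁆ ∈ V A 0 ⊔ Submodule.span ℂ {f A j}
      rw [leibniz_lie]
      exact Submodule.mem_sup_left
        (add_mem (fe_V A j i 0 x hx) (ef_span A i j 0 _ (f_V0 A j x hx)))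
  | succ k ih =>
    apply V_succ_le A (k+1) ((V A (k+1) ⊔ Submodule.span ℂ {f A j}).comap
      (LieAlgebra.ad ℂ (KM A) (f A j) : KM A →ₗ[ℂ] KM A))
    · intro x hx
      exact sup_le_sup_right (V_mono A k) _ (ih x hx)
    · intro i x hx
      change ⁅f A j, ⁅e A i, x⁆⁆ ∈ V A (k+1) ⊔ Submodule.span ℂ {f A j}
      rw [leibniz_lie]
      refine Submodule.mem_sup_left (add_mem (fe_V A j i _ x hx) ?_)
      obtain ⟨u, hu, w, hw, huw⟩ := Submodule.mem_sup.mp (ih x hx)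
      rw [← huw, lie_add]
      exact add_mem (e_V A i hu) (ef_span A i j _ w hw)

/-- The elements whose symmetrization lies in the subalgebra generated by the `Y i`. -/
noncomputable def S (A : GCM n) (ω : KM A →ₗ⁅ℂ⁆ KM A) : Submodule ℂ (KM A) :=
  (LieSubalgebra.lieSpan ℂ (KM A) (Set.range (Y A))).toSubmodule.comap
    (LinearMap.id + (ω : KM A →ₗ[ℂ] KM A))

theorem mem_S (A : GCM n) (ω : KM A →ₗ⁅ℂ⁆ KM A) (x : KM A) :
    x ∈ S A ω ↔ x + ω x ∈ LieSubalgebra.lieSpan ℂ (KM A) (Set.range (Y A)) := Iff.rfl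

theorem Y_mem (A : GCM n) (i : Fin n) :
    Y A i ∈ LieSubalgebra.lieSpan ℂ (KM A) (Set.range (Y A)) :=
  LieSubalgebra.subset_lieSpan ⟨i, rfl⟩

section
variable (A : GCM n) (ω : KM A →ₗ⁅ℂ⁆ KM A)
    (he : ∀ i, ω (e A i) = - f A i) (hf : ∀ i, ω (f A i) = - e A i)
    (hh : ∀ i, ω (h A i) = - h A i)

theorem invol (he : ∀ i, ω (e A i) = - f A i) (hf : ∀ i, ω (f A i) = - e A i)
    (hh : ∀ i, ω (h A i) = - h A i) (x : KM A) : ω (ω x) = x := by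
  let K : LieSubalgebra ℂ (KM A) :=
    { carrier := {x | ω (ω x) = x}
      add_mem' := by
        intro a b ha hb
        simp only [Set.mem_ofPred_eq] at *
        rw [map_add, map_add, ha, hb]
      zero_mem' := by simp
      smul_mem' := by
        intro c a ha
        simp only [Set.mem_ofPred_eq] at *
        rw [map_smul, map_smul, ha]
      lie_mem' := by
        intro a b ha hb
        change ω (ω a) = a at ha
        change ω (ω b) = b at hb
        change ω (ω ⁅a, b⁆) = ⁅a, b⁆
        rw [LieHom.map_lie, LieHom.map_lie, ha, hb] }
  refine mem_of_gens A K ?_ ?_ ?_ x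
  · intro i
    change ω (ω _) = _
    rw [he, map_neg, hf, neg_neg]
  · intro i
    change ω (ω _) = _
    rw [hf, map_neg, he, neg_neg]
  · intro i
    change ω (ω _) = _
    rw [hh, map_neg, hh, neg_neg]

theorem span_f_le_S (hf : ∀ i, ω (f A i) = - e A i) (j : Fin n) :
    Submodule.span ℂ {f A j} ≤ S A ω := by
  rw [Submodule.span_singleton_le_iff_mem, mem_S, hf]
  have := neg_mem (Y_mem A j)
  rw [Y, neg_sub] at this
  rwa [← sub_eq_add_neg]

theorem e_step (he : ∀ i, ω (e A i) = - f A i) (hf : ∀ i, ω (f A i) = - e A i)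
    (i : Fin n) (x : KM A) (hx : x ∈ S A ω)
    (hfx : ⁅f A i, x⁆ ∈ S A ω) : ⁅e A i, x⁆ ∈ S A ω := by
  rw [mem_S] at *
  have h1 := LieSubalgebra.lie_mem _ (Y_mem A i) hx
  have h2 := add_mem h1 hfx
  convert h2 using 1
  rw [LieHom.map_lie, LieHom.map_lie, he, hf, Y, sub_lie, lie_add, lie_add, neg_lie, neg_lie]
  abel

theorem V_le_S (he : ∀ i, ω (e A i) = - f A i) (hf : ∀ i, ω (f A i) = - e A i)
    (hh : ∀ i, ω (h A i) = - h A i) (k : ℕ) : V A k ≤ S A ω := by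
  induction k with
  | zero =>
    apply V_zero_le
    intro i
    rw [mem_S, hh, add_neg_cancel]
    exact zero_mem _
  | succ k ih =>
    apply V_succ_le _ _ _ ih
    intro i x hx
    apply e_step A ω he hf i x (ih hx)
    cases k with
    | zero => exact span_f_le_S A ω hf i (f_V0 A i x hx)
    | succ k =>
      exact sup_le ((V_mono A k).trans ih) (span_f_le_S A ω hf i) (f_V A i k x hx)

/-- The sum of the nonnegative and nonpositive parts. -/
noncomputable def P : Submodule ℂ (KM A) := ⨆ k, V A k

noncomputable def W : Submodule ℂ (KM A) := P A ⊔ (P A).map (ω : KM A →ₗ[ℂ] KM A)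

theorem V_le_P (k : ℕ) : V A k ≤ P A := le_iSup (V A) k

theorem mem_P {x : KM A} : x ∈ P A ↔ ∃ k, x ∈ V A k :=
  Submodule.mem_iSup_of_directed _ (monotone_nat_of_le_succ (V_mono A)).directed_le

theorem P_le_W : P A ≤ W A ω := le_sup_left

theorem ω_W (he : ∀ i, ω (e A i) = - f A i) (hf : ∀ i, ω (f A i) = - e A i)
    (hh : ∀ i, ω (h A i) = - h A i) {x : KM A} (hx : x ∈ W A ω) : ω x ∈ W A ω := by
  obtain ⟨u, hu, _, ⟨v, hv, rfl⟩, rfl⟩ := Submodule.mem_sup.mp hx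
  change ω (u + ω v) ∈ _
  rw [map_add, invol A ω he hf hh]
  exact add_mem (Submodule.mem_sup_right ⟨u, hu, rfl⟩) (P_le_W A ω hv)

theorem e_mem_P (i : Fin n) : e A i ∈ P A := V_le_P A 1 (e_V1 A i)

theorem f_mem_W (he : ∀ i, ω (e A i) = - f A i) (hf : ∀ i, ω (f A i) = - e A i)
    (hh : ∀ i, ω (h A i) = - h A i) (i : Fin n) : f A i ∈ W A ω := by
  have := neg_mem (ω_W A ω he hf hh (P_le_W A ω (e_mem_P A i)))
  rwa [he, neg_neg] at this

theorem f_P (he : ∀ i, ω (e A i) = - f A i) (hf : ∀ i, ω (f A i) = - e A i)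
    (hh : ∀ i, ω (h A i) = - h A i) (i : Fin n) {x : KM A} (hx : x ∈ P A) :
    ⁅f A i, x⁆ ∈ W A ω := by
  obtain ⟨k, hk⟩ := (mem_P A).mp hx
  have h1 := f_V A i k x (V_mono A k hk)
  refine sup_le ((V_le_P A k).trans (P_le_W A ω)) ?_ h1
  rw [Submodule.span_singleton_le_iff_mem]
  exact f_mem_W A ω he hf hh i

theorem e_P (i : Fin n) {x : KM A} (hx : x ∈ P A) : ⁅e A i, x⁆ ∈ W A ω := by
  obtain ⟨k, hk⟩ := (mem_P A).mp hx
  exact P_le_W A ω (V_le_P A _ (e_V A i hk))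

theorem h_P (i : Fin n) {x : KM A} (hx : x ∈ P A) : ⁅h A i, x⁆ ∈ W A ω := by
  obtain ⟨k, hk⟩ := (mem_P A).mp hx
  exact P_le_W A ω (V_le_P A _ (h_V A i k x hk))

theorem stab (he : ∀ i, ω (e A i) = - f A i) (hf : ∀ i, ω (f A i) = - e A i)
    (hh : ∀ i, ω (h A i) = - h A i) (y : KM A) (h1 : ∀ x ∈ P A, ⁅y, x⁆ ∈ W A ω)
    (h2 : ∀ x ∈ P A, ⁅ω y, x⁆ ∈ W A ω) : ∀ x ∈ W A ω, ⁅y, x⁆ ∈ W A ω := by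
  intro x hx
  obtain ⟨u, hu, _, ⟨v, hv, rfl⟩, rfl⟩ := Submodule.mem_sup.mp hx
  rw [lie_add]
  refine add_mem (h1 u hu) ?_
  change ⁅y, ω v⁆ ∈ _
  have := ω_W A ω he hf hh (h2 v hv)
  rwa [LieHom.map_lie, invol A ω he hf hh] at this

theorem mem_W (he : ∀ i, ω (e A i) = - f A i) (hf : ∀ i, ω (f A i) = - e A i)
    (hh : ∀ i, ω (h A i) = - h A i) (x : KM A) : x ∈ W A ω := by
  let K : LieSubalgebra ℂ (KM A) :=
    { carrier := {y | ∀ x ∈ W A ω, ⁅y, x⁆ ∈ W A ω}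
      add_mem' := by
        intro a b ha hb x hx
        rw [add_lie]
        exact add_mem (ha x hx) (hb x hx)
      zero_mem' := by
        intro x _
        rw [zero_lie]
        exact zero_mem _
      smul_mem' := by
        intro c a ha x hx
        rw [smul_lie]
        exact Submodule.smul_mem _ _ (ha x hx)
      lie_mem' := by
        intro a b ha hb x hx
        rw [lie_lie]
        exact sub_mem (ha _ (hb x hx)) (hb _ (ha x hx)) }
  have hK : ∀ y : KM A, ∀ x ∈ W A ω, ⁅y, x⁆ ∈ W A ω := by
    intro y
    refine mem_of_gens A K ?_ ?_ ?_ y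
    · intro i
      refine stab A ω he hf hh _ (fun x hx => e_P A ω i hx) (fun x hx => ?_)
      rw [he, neg_lie]
      exact neg_mem (f_P A ω he hf hh i hx)
    · intro i
      refine stab A ω he hf hh _ (fun x hx => f_P A ω he hf hh i hx) (fun x hx => ?_)
      rw [hf, neg_lie]
      exact neg_mem (e_P A ω i hx)
    · intro i
      refine stab A ω he hf hh _ (fun x hx => h_P A ω i hx) (fun x hx => ?_)
      rw [hh, neg_lie]
      exact neg_mem (h_P A ω i hx)
  let K' : LieSubalgebra ℂ (KM A) :=
    { W A ω with lie_mem' := fun {a b} _ hb => hK a b hb }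
  refine mem_of_gens A K' ?_ ?_ ?_ x
  · exact fun i => P_le_W A ω (e_mem_P A i)
  · exact fun i => f_mem_W A ω he hf hh i
  · exact fun i => P_le_W A ω (V_le_P A 0 (h_V0 A i))

theorem W_le_S (he : ∀ i, ω (e A i) = - f A i) (hf : ∀ i, ω (f A i) = - e A i)
    (hh : ∀ i, ω (h A i) = - h A i) : W A ω ≤ S A ω := by
  have hP : P A ≤ S A ω := iSup_le (V_le_S A ω he hf hh)
  refine sup_le hP ?_
  rintro _ ⟨x, hx, rfl⟩
  change ω x ∈ _
  rw [mem_S, invol A ω he hf hh, add_comm]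
  exact hP hx

end

end KacMoody

open KacMoody in
/-- The fixed-point Lie subalgebra `k(A) = {x ∈ g(A) : ω x = x}` of the Chevalley involution
`ω` is generated, as a Lie algebra, by the elements `Y i = e i - f i`. -/
theorem fixed_points_generated_by_Y {n : ℕ} (A : GCM n)
    (ω : KM A →ₗ⁅ℂ⁆ KM A)
    (he : ∀ i, ω (e A i) = - f A i) (hf : ∀ i, ω (f A i) = - e A i)
    (hh : ∀ i, ω (h A i) = - h A i) :
    (LieSubalgebra.lieSpan ℂ (KM A) (Set.range (Y A)) : Set (KM A)) =
      {x : KM A | ω x = x} := by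
  apply Set.Subset.antisymm
  · let K : LieSubalgebra ℂ (KM A) :=
      { carrier := {x | ω x = x}
        add_mem' := by
          intro a b ha hb
          change ω a = a at ha
          change ω b = b at hb
          change ω (a + b) = a + b
          rw [map_add, ha, hb]
        zero_mem' := by simp
        smul_mem' := by
          intro c a ha
          change ω a = a at ha
          change ω (c • a) = c • a
          rw [map_smul, ha]
        lie_mem' := by
          intro a b ha hb
          change ω a = a at ha
          change ω b = b at hb
          change ω ⁅a, b⁆ = ⁅a, b⁆
          rw [LieHom.map_lie, ha, hb] }
    have hle : LieSubalgebra.lieSpan ℂ (KM A) (Set.range (Y A)) ≤ K := by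
      rw [LieSubalgebra.lieSpan_le]
      rintro _ ⟨i, rfl⟩
      change ω (Y A i) = Y A i
      rw [Y, map_sub, he, hf]
      abel
    exact hle
  · intro x hx
    change ω x = x at hx
    have h1 := (mem_S A ω x).mp (W_le_S A ω he hf hh (mem_W A ω he hf hh x))
    rw [hx] at h1
    have h2 := LieSubalgebra.smul_mem _ (1/2 : ℂ) h1
    have h3 : (1/2 : ℂ) • (x + x) = x := by module
    rw [h3] at h2
    exact h2
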